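/- arXiv:1110.1351 — 2 statements merged into one kernel-verified Lean document; each statement's English description precedes it below -/
import Mathlib

section
/- Let G be a two-by-two game whose Player One payoffs X₁, X₂, X₃, X₄ are not all equal. Let μ be a mixed quantum strategy supported on four pairwise orthogonal unit quaternions q₁, q₂, q₃, q₄, played with probabilities α = μ({q₁}), β = μ({q₂}), γ = μ({q₃}), δ = μ({q₄}). If the unit quaternion p is an optimal response for Player One to μ, then (α−β)(α−γ)(α−δ)·K(p·q₁) + (β−α)(β−δ)(β−γ)·K(p·q₂) + (γ−α)(γ−β)(γ−δ)·K(p·q₃) + (δ−α)(δ−β)(δ−γ)·K(p·q₄) = 0. -/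
noncomputable section

open MeasureTheory

local notation "ℍ" => Quaternion ℝ

instance : MeasurableSpace (Quaternion ℝ) := borel _
instance : BorelSpace (Quaternion ℝ) := ⟨rfl⟩

/-- The four real coordinates of a quaternion: `p = π₁(p) + π₂(p)i + π₃(p)j + π₄(p)k`. -/
def piQ (t : Fin 4) (p : ℍ) : ℝ := ![p.re, p.imI, p.imJ, p.imK] t

/-- The standard inner product on ℍ ≅ ℝ⁴. -/
def qinner (p q : ℍ) : ℝ := ∑ t : Fin 4, piQ t p * piQ t q

/-- The quaternions `i`, `j`, `k`. -/
def qI : ℍ := ⟨0, 1, 0, 0⟩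
def qJ : ℍ := ⟨0, 0, 1, 0⟩
def qK : ℍ := ⟨0, 0, 0, 1⟩

/-- A mixed quantum strategy: a Borel probability measure on the unit quaternions. -/
def IsMixed (μ : Measure ℍ) : Prop :=
  IsProbabilityMeasure μ ∧ μ {p : ℍ | ‖p‖ = 1} = 1

/-- Quantum payoff with payoff vector `X`: `P^Q(p,q) = Σ_t π_t(pq)² X_t`. -/
def payoff (X : Fin 4 → ℝ) (p q : ℍ) : ℝ :=
  ∑ t : Fin 4, (piQ t (p * q)) ^ 2 * X t

/-- Expected payoff of a pair of mixed strategies. -/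
def payoffM (X : Fin 4 → ℝ) (ν μ : Measure ℍ) : ℝ :=
  ∫ p, ∫ q, payoff X p q ∂μ ∂ν

/-- Mixed-strategy Nash equilibrium of the quantum game with payoff vectors `X`, `Y`. -/
def IsNash (X Y : Fin 4 → ℝ) (ν μ : Measure ℍ) : Prop :=
  IsMixed ν ∧ IsMixed μ ∧
    (∀ ν' : Measure ℍ, IsMixed ν' → payoffM X ν' μ ≤ payoffM X ν μ) ∧
    (∀ μ' : Measure ℍ, IsMixed μ' → payoffM Y ν μ' ≤ payoffM Y ν μ)

/-- Equivalence of mixed quantum strategies. -/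
def StratEquiv (μ μ' : Measure ℍ) : Prop :=
  ∀ p : ℍ, ‖p‖ = 1 → ∀ t : Fin 4,
    ∫ q, (piQ t (p * q)) ^ 2 ∂μ = ∫ q, (piQ t (p * q)) ^ 2 ∂μ'

/-- Equivalence of pairs of mixed strategies: `(ν,μ) ∼ (ν',μ')` iff there is a unit
quaternion `u` with `ν' ∼ ν·u` and `μ' ∼ u⁻¹·μ`. -/
def PairEquiv (ν μ ν' μ' : Measure ℍ) : Prop :=
  ∃ u : ℍ, ‖u‖ = 1 ∧
    StratEquiv (Measure.map (fun p => p * u) ν) ν' ∧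
    StratEquiv (Measure.map (fun q => u⁻¹ * q) μ) μ'

/-- A generic two-by-two game: all payoffs distinct and all pairwise sums distinct. -/
def Generic (X Y : Fin 4 → ℝ) : Prop :=
  Function.Injective X ∧ Function.Injective Y ∧
    (∀ s t s' t' : Fin 4, s < t → s' < t' → X s + X t = X s' + X t' → s = s' ∧ t = t') ∧
    (∀ s t s' t' : Fin 4, s < t → s' < t' → Y s + Y t = Y s' + Y t' → s = s' ∧ t = t')

/-- `K(p) = π₁(p)π₂(p)π₃(p)π₄(p)`. -/
def K (p : ℍ) : ℝ := p.re * p.imI * p.imJ * p.imK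

/-- Intertwined quadruple of quaternions. -/
def Intertwined (p q r s : ℍ) : Prop :=
  ∃ α : ℝ, α ≠ 0 ∧ ∀ X Y : ℝ, α * K (X • p + Y • q) = K (X • r + Y • s)

/-- Fully intertwined quadruple of quaternions. -/
def FullyIntertwined (p q r s : ℍ) : Prop :=
  Intertwined p q r s ∧ Intertwined p r q s

/-- `p` is an optimal response for Player One to the mixed strategy `μ`. -/
def Optimal₁ (X : Fin 4 → ℝ) (μ : Measure ℍ) (p : ℍ) : Prop :=
  ‖p‖ = 1 ∧ ∀ p' : ℍ, ‖p'‖ = 1 → ∫ q, payoff X p' q ∂μ ≤ ∫ q, payoff X p q ∂μ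

/-- `q` is an optimal response for Player Two to the mixed strategy `ν`. -/
def Optimal₂ (Y : Fin 4 → ℝ) (ν : Measure ℍ) (q : ℍ) : Prop :=
  ‖q‖ = 1 ∧ ∀ q' : ℍ, ‖q'‖ = 1 → ∫ p, payoff Y p q' ∂ν ≤ ∫ p, payoff Y p q ∂ν

lemma normSq_eq_one {a : ℍ} (ha : ‖a‖ = 1) :
    a.re ^ 2 + a.imI ^ 2 + a.imJ ^ 2 + a.imK ^ 2 = 1 := by
  rw [← Quaternion.normSq_def', Quaternion.normSq_eq_norm_mul_self, ha, mul_one]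

lemma norm_eq_one_of_normSq {a : ℍ}
    (ha : a.re ^ 2 + a.imI ^ 2 + a.imJ ^ 2 + a.imK ^ 2 = 1) : ‖a‖ = 1 := by
  rw [← Quaternion.normSq_def', Quaternion.normSq_eq_norm_mul_self] at ha
  nlinarith [norm_nonneg a]

lemma qinner_self {a : ℍ} (ha : ‖a‖ = 1) : qinner a a = 1 := by
  rw [← normSq_eq_one ha]
  simp [qinner, piQ, Fin.sum_univ_four]
  ring

lemma qinner_mul_left {p : ℍ} (hp : ‖p‖ = 1) (a b : ℍ) :
    qinner (p * a) (p * b) = qinner a b := by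
  have h := normSq_eq_one hp
  simp [qinner, piQ, Fin.sum_univ_four]
  linear_combination
    (a.re * b.re + a.imI * b.imI + a.imJ * b.imJ + a.imK * b.imK) * h

/-- The first-order condition at a maximum of a quadratic form restricted to a circle. -/
lemma eq_zero_of_quadratic_le_on_circle {A B C : ℝ}
    (h : ∀ c s : ℝ, c ^ 2 + s ^ 2 = 1 → c ^ 2 * A + 2 * (c * s) * B + s ^ 2 * C ≤ A) :
    B = 0 := by
  have key : ∀ t : ℝ, 2 * t * B ≤ t ^ 2 * (C - A) * (-1) := by
    intro t
    have hpos : 0 < 1 + t ^ 2 := by positivity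
    have hc : (1 / √(1 + t ^ 2)) ^ 2 = 1 / (1 + t ^ 2) := by
      rw [div_pow, Real.sq_sqrt hpos.le, one_pow]
    have h1 := h (1 / √(1 + t ^ 2)) (t * (1 / √(1 + t ^ 2))) (by
      rw [mul_pow, hc]; field_simp)
    have h2 : 1 / (1 + t ^ 2) * (A + 2 * t * B + t ^ 2 * C) ≤ A := by
      rw [← hc]; linarith
    rw [one_div, inv_mul_le_iff₀ hpos] at h2
    linarith
  by_contra hB
  have hk : 0 < |A - C| + 1 := by positivity
  have h1 := key (B / (|A - C| + 1))
  have h2 : 2 * B ^ 2 * (|A - C| + 1) ≤ B ^ 2 * (A - C) := by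
    field_simp at h1
    nlinarith
  have h3 : 0 < B ^ 2 := by positivity
  nlinarith [le_abs_self (A - C), abs_nonneg (A - C)]

lemma integral_eq_sum_of_range {μ : Measure ℍ} [IsProbabilityMeasure μ] {q : Fin 4 → ℍ}
    (hq : Function.Injective q) (hsupp : μ (Set.range q) = 1) (f : ℍ → ℝ) :
    ∫ x, f x ∂μ = ∑ i, (μ {q i}).toReal * f (q i) := by
  have hr : μ.restrict (Set.range q) = μ :=
    Measure.restrict_eq_self_of_ae_mem
      ((prob_compl_eq_zero_iff (Set.finite_range q).measurableSet).2 hsupp)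
  have hs : Set.range q = ((Finset.univ.map ⟨q, hq⟩ : Finset ℍ) : Set ℍ) := by simp
  calc ∫ x, f x ∂μ = ∫ x in Set.range q, f x ∂μ := by rw [hr]
    _ = ∑ i, (μ {q i}).toReal * f (q i) := by
      rw [hs, setIntegral_finset _ IntegrableOn.finset, Finset.sum_map]
      rfl

/-- The symmetric matrix `∑ i, a i • v i (v i)ᵀ`. -/
def secondMoment (a : Fin 4 → ℝ) (v : Fin 4 → ℍ) (s t : Fin 4) : ℝ :=
  ∑ i, a i * (piQ s (v i) * piQ t (v i))

lemma sum_vandermonde_mul_K (a : Fin 4 → ℝ) (v : Fin 4 → ℍ)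
    (hv : ∀ i j, qinner (v i) (v j) = if i = j then 1 else 0) :
    ∑ i : Fin 4, (∏ j ∈ Finset.univ.erase i, (a i - a j)) * K (v i) =
      secondMoment a v 0 1 * secondMoment a v 0 2 * secondMoment a v 0 3
      + secondMoment a v 0 1 * secondMoment a v 1 2 * secondMoment a v 1 3
      + secondMoment a v 0 2 * secondMoment a v 1 2 * secondMoment a v 2 3
      + secondMoment a v 0 3 * secondMoment a v 1 3 * secondMoment a v 2 3 := by
  let V : Matrix (Fin 4) (Fin 4) ℝ := Matrix.of fun i t => piQ t (v i)
  have hV : V * V.transpose = 1 := by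
    ext i j
    rw [Matrix.mul_apply, Matrix.one_apply, ← hv i j]
    rfl
  have hV' : V.transpose * V = 1 := mul_eq_one_comm.1 hV
  let M : Matrix (Fin 4) (Fin 4) ℝ := V.transpose * Matrix.diagonal a * V
  have hdiag : ∀ (b : Fin 4 → ℝ) (s t : Fin 4),
      secondMoment b v s t = (V.transpose * Matrix.diagonal b * V) s t := by
    intro b s t
    rw [Matrix.mul_apply]
    refine Finset.sum_congr rfl fun i _ => ?_
    rw [Matrix.mul_diagonal, Matrix.transpose_apply]
    simp only [V, Matrix.of_apply]
    ring
  have hM : ∀ s t, secondMoment a v s t = M s t := hdiag a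
  have hsymm : ∀ s t, secondMoment a v s t = secondMoment a v t s := fun s t =>
    Finset.sum_congr rfl fun i _ => by ring
  have htr : ∑ t, secondMoment a v t t = ∑ i, a i := by
    have h : M.trace = (Matrix.diagonal a).trace := by
      rw [Matrix.trace_mul_comm, ← mul_assoc, hV, one_mul]
    simpa [Matrix.trace, hM] using h
  have hsq : ∀ s t, secondMoment (fun i => a i ^ 2) v s t =
      ∑ r, secondMoment a v s r * secondMoment a v r t := by
    intro s t
    have h : M * M = V.transpose * Matrix.diagonal (fun i => a i ^ 2) * V := by
      calc M * M = V.transpose * Matrix.diagonal a * (V * V.transpose) *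
            Matrix.diagonal a * V := by simp only [M, mul_assoc]
        _ = _ := by
          rw [hV, mul_one, mul_assoc V.transpose, Matrix.diagonal_mul_diagonal]
          simp only [pow_two]
    have h' := congrFun (congrFun h s) t
    rw [Matrix.mul_apply] at h'
    simp only [hM, h', hdiag]
  have horth : ∀ s t, s ≠ t → ∑ i, piQ s (v i) * piQ t (v i) = 0 := by
    intro s t hst
    have h := congrFun (congrFun hV' s) t
    rwa [Matrix.mul_apply, Matrix.one_apply_ne hst] at h
  have hspec : ∑ i : Fin 4, (∏ j ∈ Finset.univ.erase i, (a i - a j)) * K (v i) =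
      secondMoment a v 0 1 * secondMoment (fun i => a i ^ 2) v 2 3
      + secondMoment a v 2 3 * secondMoment (fun i => a i ^ 2) v 0 1
      - (∑ i, a i) * secondMoment a v 0 1 * secondMoment a v 2 3 := by
    have h01 := horth 0 1 (by decide)
    have h23 := horth 2 3 (by decide)
    have e0 : (Finset.univ : Finset (Fin 4)).erase 0 = {1, 2, 3} := by decide
    have e1 : (Finset.univ : Finset (Fin 4)).erase 1 = {0, 2, 3} := by decide
    have e2 : (Finset.univ : Finset (Fin 4)).erase 2 = {0, 1, 3} := by decide
    have e3 : (Finset.univ : Finset (Fin 4)).erase 3 = {0, 1, 2} := by decide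
    simp [Fin.sum_univ_four, e0, e1, e2, e3, K, secondMoment, piQ] at h01 h23 ⊢
    linear_combination
      ((a 1 * a 2 * a 3 + a 0 * a 2 * a 3 + a 0 * a 1 * a 3 + a 0 * a 1 * a 2)
        * ((v 0).re * (v 0).imI + (v 1).re * (v 1).imI + (v 2).re * (v 2).imI + (v 3).re * (v 3).imI)
        - (a 1 * a 2 * a 3 * ((v 0).re * (v 0).imI)
        + a 0 * a 2 * a 3 * ((v 1).re * (v 1).imI)
        + a 0 * a 1 * a 3 * ((v 2).re * (v 2).imI)
        + a 0 * a 1 * a 2 * ((v 3).re * (v 3).imI))) * h23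
      - (a 1 * a 2 * a 3 * ((v 0).imJ * (v 0).imK)
        + a 0 * a 2 * a 3 * ((v 1).imJ * (v 1).imK)
        + a 0 * a 1 * a 3 * ((v 2).imJ * (v 2).imK)
        + a 0 * a 1 * a 2 * ((v 3).imJ * (v 3).imK)) * h01
  rw [hspec, hsq 2 3, hsq 0 1, ← htr]
  simp only [Fin.sum_univ_four]
  rw [hsymm 2 0, hsymm 2 1, hsymm 3 1]
  ring

/-- Derivative of the expected payoff along the circle through `p` and `u * p`. -/
lemma sum_mul_piQ_eq_zero_of_optimal {X : Fin 4 → ℝ} {μ : Measure ℍ} {p : ℍ}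
    {q : Fin 4 → ℍ} {a : Fin 4 → ℝ}
    (hint : ∀ f : ℍ → ℝ, ∫ x, f x ∂μ = ∑ i, a i * f (q i)) (hp : Optimal₁ X μ p)
    {u : ℍ} (hu : ‖u‖ = 1) (hre : u.re = 0) :
    ∑ i, a i * ∑ t, piQ t (p * q i) * piQ t (u * (p * q i)) * X t = 0 := by
  apply eq_zero_of_quadratic_le_on_circle
    (A := ∑ i, a i * payoff X p (q i)) (C := ∑ i, a i * payoff X (u * p) (q i))
  intro c s hcs
  have hu' := normSq_eq_one hu
  rw [hre] at hu'
  have hw : ‖(c : ℍ) + s • u‖ = 1 := by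
    apply norm_eq_one_of_normSq
    simp [hre]
    linear_combination hcs + s ^ 2 * hu'
  have hmax := hp.2 (((c : ℍ) + s • u) * p) (by rw [norm_mul, hw, hp.1, one_mul])
  rw [hint, hint] at hmax
  refine le_of_eq_of_le ?_ hmax
  have hlin : ∀ (t : Fin 4) (i : Fin 4), piQ t (((c : ℍ) + s • u) * p * q i) =
      c * piQ t (p * q i) + s * piQ t (u * (p * q i)) := by
    intro t i
    rw [mul_assoc, add_mul]
    generalize p * q i = v
    rw [smul_mul_assoc]
    fin_cases t <;> simp [piQ]
  simp only [payoff, hlin, mul_assoc u p, Finset.mul_sum, ← Finset.sum_add_distrib]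
  exact Finset.sum_congr rfl fun i _ => Finset.sum_congr rfl fun t _ => by ring

lemma exists_eq_mul_of_mul_eq_mul {u w x y : ℝ} (h : u * x = w * y) (hne : u ≠ 0 ∨ w ≠ 0) :
    ∃ m, x = w * m ∧ y = u * m := by
  have hpos : u ^ 2 + w ^ 2 ≠ 0 := by
    rcases hne with h | h <;> positivity
  refine ⟨(w * x + u * y) / (u ^ 2 + w ^ 2), ?_, ?_⟩
  · field_simp
    linear_combination u * h
  · field_simp
    linear_combination (-w) * h

lemma sum_triple_products_eq_zero {x₀ x₁ x₂ x₃ m₀₁ m₀₂ m₀₃ m₁₂ m₁₃ m₂₃ : ℝ}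
    (hx : ¬ (x₁ = x₀ ∧ x₂ = x₀ ∧ x₃ = x₀))
    (hI : (x₁ - x₀) * m₀₁ = (x₂ - x₃) * m₂₃)
    (hJ : (x₂ - x₀) * m₀₂ = (x₃ - x₁) * m₁₃)
    (hK : (x₃ - x₀) * m₀₃ = (x₁ - x₂) * m₁₂) :
    m₀₁ * m₀₂ * m₀₃ + m₀₁ * m₁₂ * m₁₃ + m₀₂ * m₁₂ * m₂₃ + m₀₃ * m₁₃ * m₂₃ = 0 := by
  by_cases h1 : x₁ = x₀ ∧ x₂ = x₃
  · obtain ⟨rfl, rfl⟩ := h1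
    have hne : x₂ - x₁ ≠ 0 := fun h => hx ⟨rfl, by linarith, by linarith⟩
    have e1 : m₀₂ = m₁₃ := mul_left_cancel₀ hne hJ
    have e2 : m₀₃ = -m₁₂ := mul_left_cancel₀ hne (by linarith)
    rw [e1, e2]; ring
  by_cases h2 : x₂ = x₀ ∧ x₃ = x₁
  · obtain ⟨rfl, rfl⟩ := h2
    have hne : x₃ - x₂ ≠ 0 := fun h => hx ⟨by linarith, rfl, by linarith⟩
    have e1 : m₀₁ = -m₂₃ := mul_left_cancel₀ hne (by linarith)
    have e2 : m₀₃ = m₁₂ := mul_left_cancel₀ hne hK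
    rw [e1, e2]; ring
  by_cases h3 : x₃ = x₀ ∧ x₁ = x₂
  · obtain ⟨rfl, rfl⟩ := h3
    have hne : x₁ - x₃ ≠ 0 := fun h => hx ⟨by linarith, by linarith, rfl⟩
    have e1 : m₀₁ = m₂₃ := mul_left_cancel₀ hne hI
    have e2 : m₀₂ = -m₁₃ := mul_left_cancel₀ hne (by linarith)
    rw [e1, e2]; ring
  simp only [← sub_eq_zero (b := x₀), ← sub_eq_zero (b := x₃), ← sub_eq_zero (b := x₁),
    ← sub_eq_zero (b := x₂), not_and_or] at h1 h2 h3
  obtain ⟨m, rfl, rfl⟩ := exists_eq_mul_of_mul_eq_mul hI h1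
  obtain ⟨n, rfl, rfl⟩ := exists_eq_mul_of_mul_eq_mul hJ h2
  obtain ⟨r, rfl, rfl⟩ := exists_eq_mul_of_mul_eq_mul hK h3
  ring

/-- If the `X_t` are not all equal, `μ` is supported on four pairwise
orthogonal unit quaternions `q i` with probabilities `a i = μ {q i}`, and `p` is an
optimal response for Player One to `μ`, then
`Σ_i (Π_{j ≠ i} (a i − a j)) · K(p · q i) = 0`. -/
theorem optimal_response_K_relation (X : Fin 4 → ℝ) (hX : ¬ ∀ s t : Fin 4, X s = X t)
    (μ : Measure ℍ) (hμ : IsMixed μ)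
    (q : Fin 4 → ℍ) (hq1 : ∀ i, ‖q i‖ = 1)
    (hq2 : ∀ i j, i ≠ j → qinner (q i) (q j) = 0)
    (hsupp : μ (Set.range q) = 1)
    (p : ℍ) (hp : Optimal₁ X μ p) :
    ∑ i : Fin 4,
        (∏ j ∈ Finset.univ.erase i, ((μ {q i}).toReal - (μ {q j}).toReal)) * K (p * q i)
      = 0 := by
  have := hμ.1
  have hqq : ∀ i j, qinner (q i) (q j) = if i = j then 1 else 0 := by
    intro i j
    split_ifs with h
    · rw [h, qinner_self (hq1 j)]
    · exact hq2 i j h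
  have hinj : Function.Injective q := by
    intro i j h
    by_contra hne
    have h0 := hq2 i j hne
    rw [h, qinner_self (hq1 j)] at h0
    exact one_ne_zero h0
  have hv : ∀ i j, qinner (p * q i) (p * q j) = if i = j then 1 else 0 := fun i j => by
    rw [qinner_mul_left hp.1, hqq]
  have hopt : ∀ u : ℍ, ‖u‖ = 1 → u.re = 0 → _ := fun u hu hre =>
    sum_mul_piQ_eq_zero_of_optimal (integral_eq_sum_of_range hinj hsupp) hp hu hre
  have hI := hopt qI (norm_eq_one_of_normSq (by simp [qI])) rfl
  have hJ := hopt qJ (norm_eq_one_of_normSq (by simp [qJ])) rfl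
  have hK := hopt qK (norm_eq_one_of_normSq (by simp [qK])) rfl
  obtain ⟨v, hpq⟩ : ∃ v : Fin 4 → ℍ, ∀ i, p * q i = v i := ⟨_, fun _ => rfl⟩
  obtain ⟨a, ha⟩ : ∃ a : Fin 4 → ℝ, ∀ i, (μ {q i}).toReal = a i := ⟨_, fun _ => rfl⟩
  simp only [hpq, ha] at hv hI hJ hK ⊢
  rw [sum_vandermonde_mul_K a v hv]
  refine sum_triple_products_eq_zero (x₀ := X 0) (x₁ := X 1) (x₂ := X 2) (x₃ := X 3) ?_ ?_ ?_ ?_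
  · rintro ⟨h1, h2, h3⟩
    have h : ∀ s, X s = X 0 := fun s => by fin_cases s <;> simp [h1, h2, h3]
    exact hX fun s t => (h s).trans (h t).symm
  all_goals
    simp [secondMoment, Fin.sum_univ_four, piQ] at hI hJ hK ⊢
    simp only [qI, qJ, qK] at hI hJ hK
  · linear_combination hI
  · linear_combination hJ
  · linear_combination hK
end
end

section
/- Let G be a generic two-by-two game and let (ν,μ) be a mixed-strategy Nash equilibrium of G^Q. Suppose μ is supported on a subset of {1, u, v, u·v}, where u and v are unit quaternions with u² = v² = −1 and u·v + v·u = 0, and suppose ν is supported on exactly three pairwise orthogonal unit quaternions. Then (ν,μ) is equivalent as a pair to a pair (ν',μ') in which each of ν' and μ' is supported on a three-element subset of {1, i, j, k}. -/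
noncomputable section

open MeasureTheory

local notation "ℍ" => Quaternion ℝ

/-- The matrix of the rotation of the imaginary quaternions induced by `p`, scaled by `‖p‖²`. -/
def rot (p : ℍ) : Matrix (Fin 3) (Fin 3) ℝ :=
  !![p.re ^ 2 + p.imI ^ 2 - p.imJ ^ 2 - p.imK ^ 2, 2 * (p.imI * p.imJ - p.re * p.imK),
      2 * (p.imI * p.imK + p.re * p.imJ);
    2 * (p.imI * p.imJ + p.re * p.imK), p.re ^ 2 - p.imI ^ 2 + p.imJ ^ 2 - p.imK ^ 2,
      2 * (p.imJ * p.imK - p.re * p.imI);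
    2 * (p.imI * p.imK - p.re * p.imJ), 2 * (p.imJ * p.imK + p.re * p.imI),
      p.re ^ 2 - p.imI ^ 2 - p.imJ ^ 2 + p.imK ^ 2]

/-- The mean of `rot` under a mixed strategy; it determines the strategy up to equivalence. -/
def meanRot (μ : Measure ℍ) : Matrix (Fin 3) (Fin 3) ℝ :=
  Matrix.of fun i j => ∫ q, rot q i j ∂μ

/-- The coordinate vector of a quaternion. -/
def coords (p : ℍ) : Fin 4 → ℝ := fun t => piQ t p

/-- The symmetric matrix of the quadratic form `p ↦ tr (C * rot p)`. -/
def coordForm (C : Matrix (Fin 3) (Fin 3) ℝ) : Matrix (Fin 4) (Fin 4) ℝ :=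
  !![C 0 0 + C 1 1 + C 2 2, C 1 2 - C 2 1, C 2 0 - C 0 2, C 0 1 - C 1 0;
    C 1 2 - C 2 1, C 0 0 - C 1 1 - C 2 2, C 0 1 + C 1 0, C 2 0 + C 0 2;
    C 2 0 - C 0 2, C 0 1 + C 1 0, - C 0 0 + C 1 1 - C 2 2, C 1 2 + C 2 1;
    C 0 1 - C 1 0, C 2 0 + C 0 2, C 1 2 + C 2 1, - C 0 0 - C 1 1 + C 2 2]

/-- The nontrivial Walsh coefficients of a payoff vector, as a diagonal matrix. -/
def payoffMatrix (X : Fin 4 → ℝ) : Matrix (Fin 3) (Fin 3) ℝ :=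
  Matrix.diagonal ![X 0 + X 1 - X 2 - X 3, X 0 - X 1 + X 2 - X 3, X 0 - X 1 - X 2 + X 3]

/-- The quaternions `1, i, j, k`. -/
def basisQ : Fin 4 → ℍ := ![1, qI, qJ, qK]

/-- `L` bounds the linear functional given by `C` on all rotations. -/
def IsRotBound (C : Matrix (Fin 3) (Fin 3) ℝ) (L : ℝ) : Prop :=
  ∀ p : ℍ, ‖p‖ = 1 → (C * rot p).trace ≤ L

/-- The measure on `{1, i, j, k}` whose weights are the mean squared coordinates of `μ`. -/
def diagMeasure (μ : Measure ℍ) : Measure ℍ :=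
  ∑ t : Fin 4, ENNReal.ofReal (∫ q, piQ t q ^ 2 ∂μ) • Measure.dirac (basisQ t)

theorem norm_sq_eq_coords (p : ℍ) :
    ‖p‖ ^ 2 = p.re ^ 2 + p.imI ^ 2 + p.imJ ^ 2 + p.imK ^ 2 := by
  rw [sq, ← Quaternion.normSq_eq_norm_mul_self]
  exact Quaternion.normSq_def' p

theorem sq_coords_of_norm_eq_one {p : ℍ} (hp : ‖p‖ = 1) :
    p.re ^ 2 + p.imI ^ 2 + p.imJ ^ 2 + p.imK ^ 2 = 1 := by
  rw [← norm_sq_eq_coords, hp, one_pow]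

theorem norm_eq_one_of_sq_coords {p : ℍ}
    (hp : p.re ^ 2 + p.imI ^ 2 + p.imJ ^ 2 + p.imK ^ 2 = 1) : ‖p‖ = 1 := by
  rw [← norm_sq_eq_coords] at hp
  exact (pow_eq_one_iff_of_nonneg (norm_nonneg p) two_ne_zero).1 hp

theorem qinner_eq (p q : ℍ) :
    qinner p q = p.re * q.re + p.imI * q.imI + p.imJ * q.imJ + p.imK * q.imK := by
  simp [qinner, piQ, Fin.sum_univ_four]

theorem rot_one : rot 1 = 1 := by
  have h0 : (1 : ℍ).re = 1 := rfl
  have h1 : (1 : ℍ).imI = 0 := rfl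
  have h2 : (1 : ℍ).imJ = 0 := rfl
  have h3 : (1 : ℍ).imK = 0 := rfl
  ext i j
  fin_cases i <;> fin_cases j <;> simp [rot, h0, h1, h2, h3]

theorem rot_mul (p q : ℍ) : rot (p * q) = rot p * rot q := by
  ext i j
  fin_cases i <;> fin_cases j <;>
    simp [rot, Matrix.mul_apply, Fin.sum_univ_three] <;> ring

theorem rot_mul_transpose {p : ℍ} (hp : ‖p‖ = 1) : rot p * (rot p).transpose = 1 := by
  have h := sq_coords_of_norm_eq_one hp
  have h2 : (p.re ^ 2 + p.imI ^ 2 + p.imJ ^ 2 + p.imK ^ 2) ^ 2 = 1 := by rw [h, one_pow]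
  ext i j
  fin_cases i <;> fin_cases j <;>
    simp [rot, Matrix.mul_apply, Fin.sum_univ_three] <;> first | ring1 | linear_combination h2

theorem trace_mul_rot (C : Matrix (Fin 3) (Fin 3) ℝ) (p : ℍ) :
    (C * rot p).trace = coords p ⬝ᵥ (coordForm C).mulVec (coords p) := by
  simp [Matrix.trace, Matrix.mul_apply, Fin.sum_univ_three, Fin.sum_univ_four, rot, coordForm,
    dotProduct, Matrix.mulVec, coords, piQ]
  ring

theorem trace_transpose_rot_mul_rot (r p : ℍ) :
    ((rot r).transpose * rot p).trace = 4 * qinner r p ^ 2 - ‖r‖ ^ 2 * ‖p‖ ^ 2 := by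
  simp [Matrix.trace, Matrix.mul_apply, Fin.sum_univ_three, rot, qinner_eq, norm_sq_eq_coords]
  ring

theorem coordForm_transpose_rot (r : ℍ) (s t : Fin 4) :
    coordForm (rot r).transpose s t =
      4 * piQ s r * piQ t r - (if s = t then ‖r‖ ^ 2 else 0) := by
  rw [norm_sq_eq_coords]
  fin_cases s <;> fin_cases t <;> simp [coordForm, rot, piQ] <;> ring

theorem coordForm_injective : Function.Injective coordForm := by
  intro C D h
  have h' : ∀ s t, coordForm C s t = coordForm D s t := fun s t => by rw [h]
  have h00 := h' 0 0
  have h11 := h' 1 1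
  have h22 := h' 2 2
  have h33 := h' 3 3
  have h01 := h' 0 1
  have h02 := h' 0 2
  have h03 := h' 0 3
  have h12 := h' 1 2
  have h13 := h' 1 3
  have h23 := h' 2 3
  simp [coordForm] at h00 h11 h22 h33 h01 h02 h03 h12 h13 h23
  ext i j
  fin_cases i <;> fin_cases j <;> simp <;> linarith

theorem coordForm_symm (C : Matrix (Fin 3) (Fin 3) ℝ) (s t : Fin 4) :
    coordForm C s t = coordForm C t s := by
  fin_cases s <;> fin_cases t <;> simp [coordForm]

theorem coordForm_trace (C : Matrix (Fin 3) (Fin 3) ℝ) : (coordForm C).trace = 0 := by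
  simp [Matrix.trace, Fin.sum_univ_four, coordForm]
  ring

theorem payoff_eq (X : Fin 4 → ℝ) (p q : ℍ) :
    payoff X p q = ((∑ t, X t) * (‖p‖ ^ 2 * ‖q‖ ^ 2) +
      (payoffMatrix X * rot p * rot q).trace) / 4 := by
  rw [mul_assoc, ← rot_mul, ← mul_pow, ← norm_mul, norm_sq_eq_coords]
  simp only [payoff, payoffMatrix, Matrix.trace, Matrix.diag, Matrix.diagonal_mul,
    Fin.sum_univ_three, Fin.sum_univ_four]
  generalize p * q = r
  simp [rot, piQ]
  ring

theorem piQ_mul_sq_eq_payoff (t : Fin 4) (p q : ℍ) :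
    piQ t (p * q) ^ 2 = payoff (Pi.single t 1) p q := by
  simp [payoff, Pi.single_apply]

/-! ### Maximisers of linear functionals on rotations -/

theorem IsRotBound.dotProduct_le {C : Matrix (Fin 3) (Fin 3) ℝ} {L : ℝ} (h : IsRotBound C L)
    (x : Fin 4 → ℝ) : x ⬝ᵥ (coordForm C).mulVec x ≤ L * (x ⬝ᵥ x) := by
  obtain ⟨p, rfl⟩ : ∃ p : ℍ, coords p = x :=
    ⟨⟨x 0, x 1, x 2, x 3⟩, by ext t; fin_cases t <;> rfl⟩
  have hself : coords p ⬝ᵥ coords p = ‖p‖ ^ 2 := by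
    rw [norm_sq_eq_coords]
    simp [dotProduct, Fin.sum_univ_four, coords, piQ]
    ring
  rw [hself]
  rcases eq_or_ne p 0 with rfl | hp
  · have h0 : coords (0 : ℍ) = 0 := by
      ext t
      fin_cases t <;> rfl
    simp [h0]
  have hn : ‖p‖ ≠ 0 := norm_ne_zero_iff.2 hp
  have h1 := h (‖p‖⁻¹ • p) (by rw [norm_smul]; simp [hn])
  have hc : coords (‖p‖⁻¹ • p) = ‖p‖⁻¹ • coords p := by
    ext t
    fin_cases t <;> simp [coords, piQ]
  rw [trace_mul_rot, hc, Matrix.mulVec_smul, smul_dotProduct, dotProduct_smul, smul_eq_mul,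
    smul_eq_mul] at h1
  have h2 : 0 < ‖p‖ ^ 2 := by positivity
  calc _ = ‖p‖ ^ 2 * (‖p‖⁻¹ * (‖p‖⁻¹ * (coords p ⬝ᵥ (coordForm C).mulVec (coords p)))) := by
        field_simp
    _ ≤ ‖p‖ ^ 2 * L := by gcongr
    _ = _ := mul_comm _ _

theorem coords_dotProduct (p q : ℍ) : coords p ⬝ᵥ coords q = qinner p q := rfl

theorem qinner_self_s13 (p : ℍ) : qinner p p = ‖p‖ ^ 2 := by
  rw [qinner_eq, norm_sq_eq_coords]
  ring

theorem IsRotBound.mulVec_eq {C : Matrix (Fin 3) (Fin 3) ℝ} {L : ℝ} (h : IsRotBound C L)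
    {q : ℍ} (hq : ‖q‖ = 1) (hqL : (C * rot q).trace = L) :
    (coordForm C).mulVec (coords q) = L • coords q := by
  have hps : (L • (1 : Matrix (Fin 4) (Fin 4) ℝ) - coordForm C).PosSemidef := by
    refine Matrix.PosSemidef.of_dotProduct_mulVec_nonneg ?_ fun x => ?_
    · ext s t
      simp [Matrix.one_apply, coordForm_symm C s t, eq_comm]
    · simpa [Matrix.sub_mulVec, Matrix.smul_mulVec, dotProduct_sub] using h.dotProduct_le x
  have h0 := (hps.dotProduct_mulVec_zero_iff (coords q)).1 (by
    simp [Matrix.sub_mulVec, Matrix.smul_mulVec, dotProduct_sub, ← trace_mul_rot, hqL,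
      coords_dotProduct, qinner_self_s13, hq])
  rw [Matrix.sub_mulVec, Matrix.smul_mulVec, Matrix.one_mulVec, sub_eq_zero] at h0
  exact h0.symm

theorem exists_orthogonal_unit {q : Fin 3 → ℍ} (hq1 : ∀ i, ‖q i‖ = 1)
    (hq2 : ∀ i j, i ≠ j → qinner (q i) (q j) = 0) :
    ∃ r : ℍ, ‖r‖ = 1 ∧ ∀ i, qinner r (q i) = 0 := by
  refine ⟨q 1 * star (q 0) * q 2, by simp [hq1], ?_⟩
  have h01 := hq2 0 1 (by decide)
  have h02 := hq2 0 2 (by decide)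
  have h12 := hq2 1 2 (by decide)
  have e (i) := sq_coords_of_norm_eq_one (hq1 i)
  rw [qinner_eq] at h01 h02 h12
  intro i
  rw [qinner_eq]
  fin_cases i <;> simp
  · linear_combination 2 * h01 * ((q 0).re * (q 2).re + (q 0).imI * (q 2).imI
      + (q 0).imJ * (q 2).imJ + (q 0).imK * (q 2).imK) - h12 * ((q 0).re ^ 2
      + (q 0).imI ^ 2 + (q 0).imJ ^ 2 + (q 0).imK ^ 2)
  · linear_combination h02 * ((q 1).re ^ 2
      + (q 1).imI ^ 2 + (q 1).imJ ^ 2 + (q 1).imK ^ 2)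
  · linear_combination h01 * ((q 2).re ^ 2
      + (q 2).imI ^ 2 + (q 2).imJ ^ 2 + (q 2).imK ^ 2)

/-- A traceless symmetric matrix annihilating three vectors of an orthonormal basis vanishes. -/
theorem eq_zero_of_mulVec_eq_zero {G : Matrix (Fin 4) (Fin 4) ℝ} (hG : G.transpose = G)
    (htr : G.trace = 0) {q : Fin 3 → ℍ} {r : ℍ} (hq1 : ∀ i, ‖q i‖ = 1)
    (hq2 : ∀ i j, i ≠ j → qinner (q i) (q j) = 0) (hr : ‖r‖ = 1)
    (hrq : ∀ i, qinner r (q i) = 0) (h : ∀ i, G.mulVec (coords (q i)) = 0) : G = 0 := by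
  let b : Fin 4 → ℍ := Fin.cons r q
  let Q : Matrix (Fin 4) (Fin 4) ℝ := Matrix.of fun i => coords (b i)
  have hQ : Q * Q.transpose = 1 := by
    ext i j
    change qinner (b i) (b j) = _
    refine Fin.cases ?_ (fun i => ?_) i <;> refine Fin.cases ?_ (fun j => ?_) j
    · simp [b, qinner_self_s13, hr]
    · simp [b, hrq, (Fin.succ_ne_zero j).symm]
    · have : qinner (q i) r = 0 := by rw [← hrq i, qinner_eq, qinner_eq]; ring
      simp [b, this]
    · by_cases hij : i = j
      · subst hij
        simp [b, qinner_self_s13, hq1]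
      · simp [b, hij, hq2]
  have hQ' : Q.transpose * Q = 1 := mul_eq_one_comm.1 hQ
  have hcol : ∀ i (j : Fin 3), (Q * G * Q.transpose) i j.succ = 0 := by
    intro i j
    rw [Matrix.mul_assoc]
    have : ∀ s, (G * Q.transpose) s j.succ = 0 := fun s => congrFun (h j) s
    simp [Matrix.mul_apply, this] at *
  have hsymm : (Q * G * Q.transpose).transpose = Q * G * Q.transpose := by
    simp [Matrix.transpose_mul, hG, Matrix.mul_assoc]
  have hrow : ∀ (i : Fin 3) j, (Q * G * Q.transpose) i.succ j = 0 := by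
    intro i j
    rw [← hsymm, Matrix.transpose_apply, hcol]
  have htr' : (Q * G * Q.transpose).trace = 0 := by
    rw [Matrix.trace_mul_comm, ← Matrix.mul_assoc, hQ', Matrix.one_mul, htr]
  have hz : Q * G * Q.transpose = 0 := by
    ext i j
    refine Fin.cases ?_ (fun i => hrow i j) i
    refine Fin.cases ?_ (fun j => hcol 0 j) j
    rw [Matrix.trace, Fin.sum_univ_succ] at htr'
    simpa [hcol] using htr'
  calc G = (Q.transpose * Q) * G * (Q.transpose * Q) := by rw [hQ']; simp
    _ = Q.transpose * (Q * G * Q.transpose) * Q := by simp only [Matrix.mul_assoc]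
    _ = 0 := by rw [hz]; simp

theorem IsRotBound.eq_smul_transpose_rot {C : Matrix (Fin 3) (Fin 3) ℝ} {L : ℝ}
    (h : IsRotBound C L) {q : Fin 3 → ℍ} {r : ℍ} (hq1 : ∀ i, ‖q i‖ = 1)
    (hq2 : ∀ i j, i ≠ j → qinner (q i) (q j) = 0) (hr : ‖r‖ = 1)
    (hrq : ∀ i, qinner r (q i) = 0) (hqL : ∀ i, (C * rot (q i)).trace = L) :
    C = (-L) • (rot r).transpose := by
  apply coordForm_injective
  have hneg : coordForm ((-L) • (rot r).transpose) = (-L) • coordForm (rot r).transpose := by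
    ext s t
    fin_cases s <;> fin_cases t <;> simp [coordForm] <;> ring
  rw [hneg, ← sub_eq_zero]
  refine eq_zero_of_mulVec_eq_zero (q := q) ?_ ?_ hq1 hq2 hr hrq fun i => ?_
  · ext s t
    simp [coordForm_symm _ t s]
  · simp [coordForm_trace]
  · rw [Matrix.sub_mulVec, h.mulVec_eq (hq1 i) (hqL i), Matrix.smul_mulVec]
    have : (coordForm (rot r).transpose).mulVec (coords (q i)) = - coords (q i) := by
      ext s
      have hi := hrq i
      simp only [Matrix.mulVec, dotProduct, coordForm_transpose_rot, sub_mul, ite_mul, zero_mul,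
        Finset.sum_sub_distrib, Finset.sum_ite_eq, Finset.mem_univ, if_true, hr]
      have : ∑ t, 4 * piQ s r * piQ t r * coords (q i) t = 4 * piQ s r * qinner r (q i) := by
        rw [qinner, Finset.mul_sum]
        exact Finset.sum_congr rfl fun t _ => by rw [coords]; ring
      rw [this, hi]
      simp
    rw [this]
    simp

theorem norm_basisQ (t : Fin 4) : ‖basisQ t‖ = 1 := by
  fin_cases t
  · exact norm_one
  all_goals
    apply norm_eq_one_of_sq_coords
    simp [basisQ, qI, qJ, qK]

theorem coords_basisQ (t : Fin 4) : coords (basisQ t) = Pi.single t 1 := by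
  ext s
  fin_cases t <;> fin_cases s <;> rfl

theorem basisQ_injective : Function.Injective basisQ := by
  intro s t h
  have h' := congrFun (congrArg coords h) s
  rw [coords_basisQ, coords_basisQ] at h'
  by_contra hst
  simp [hst] at h'

theorem IsRotBound.coordForm_apply {C : Matrix (Fin 3) (Fin 3) ℝ} {L : ℝ} (h : IsRotBound C L)
    {t : Fin 4} (ht : (C * rot (basisQ t)).trace = L) (s : Fin 4) :
    coordForm C s t = if s = t then L else 0 := by
  have := congrFun (h.mulVec_eq (norm_basisQ t) ht) s
  simpa [coords_basisQ, Pi.single_apply] using this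

theorem IsRotBound.isDiag {C : Matrix (Fin 3) (Fin 3) ℝ} {L : ℝ} (h : IsRotBound C L)
    (hgood : ∀ s t, s ≠ t →
      (C * rot (basisQ s)).trace = L ∨ (C * rot (basisQ t)).trace = L) : C.IsDiag := by
  have hoff : ∀ s t, s ≠ t → coordForm C s t = 0 := by
    intro s t hst
    rcases hgood s t hst with hs | ht
    · rw [coordForm_symm, h.coordForm_apply hs, if_neg hst.symm]
    · rw [h.coordForm_apply ht, if_neg hst]
  have h01 := hoff 0 1 (by decide)
  have h02 := hoff 0 2 (by decide)
  have h03 := hoff 0 3 (by decide)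
  have h12 := hoff 1 2 (by decide)
  have h13 := hoff 1 3 (by decide)
  have h23 := hoff 2 3 (by decide)
  simp [coordForm] at h01 h02 h03 h12 h13 h23
  intro i j hij
  fin_cases i <;> fin_cases j <;> simp at hij ⊢ <;> linarith

theorem IsRotBound.eq_zero {C : Matrix (Fin 3) (Fin 3) ℝ} {L : ℝ} (h : IsRotBound C L)
    (hgood : ∀ t, (C * rot (basisQ t)).trace = L) : C = 0 := by
  apply coordForm_injective
  have hL : L = 0 := by
    have := coordForm_trace C
    simpa [Matrix.trace, h.coordForm_apply (hgood _)] using this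
  ext s t
  rw [h.coordForm_apply (hgood t), hL]
  fin_cases s <;> fin_cases t <;> simp [coordForm]

/-! ### Mean rotations of mixed strategies -/

theorem IsMixed.ae_norm_eq_one {μ : Measure ℍ} (hμ : IsMixed μ) : ∀ᵐ q ∂μ, ‖q‖ = 1 := by
  have := hμ.1
  exact (mem_ae_iff_prob_eq_one (measurableSet_eq_fun continuous_norm.measurable
    measurable_const)).2 hμ.2

theorem IsMixed.integrable {μ : Measure ℍ} (hμ : IsMixed μ) {f : ℍ → ℝ} (hf : Continuous f) :
    Integrable f μ := by
  have := hμ.1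
  obtain ⟨c, hc⟩ := (isCompact_sphere (0 : ℍ) 1).exists_bound_of_continuousOn hf.continuousOn
  refine Integrable.of_bound hf.aestronglyMeasurable c ?_
  filter_upwards [hμ.ae_norm_eq_one] with q hq
  exact hc q (by simpa using hq)

theorem continuous_piQ (t : Fin 4) : Continuous (piQ t) := by
  fin_cases t
  exacts [Quaternion.continuous_re, Quaternion.continuous_imI, Quaternion.continuous_imJ,
    Quaternion.continuous_imK]

theorem continuous_rot (i j : Fin 3) : Continuous fun p => rot p i j := by
  have h0 := Quaternion.continuous_re
  have h1 := Quaternion.continuous_imI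
  have h2 := Quaternion.continuous_imJ
  have h3 := Quaternion.continuous_imK
  fin_cases i <;> fin_cases j <;> simp [rot] <;> fun_prop

theorem continuous_trace_mul_rot (C : Matrix (Fin 3) (Fin 3) ℝ) :
    Continuous fun p => (C * rot p).trace := by
  simp only [Matrix.trace, Matrix.diag, Matrix.mul_apply]
  have := continuous_rot
  fun_prop

theorem IsMixed.integral_trace {μ : Measure ℍ} (hμ : IsMixed μ)
    (C : Matrix (Fin 3) (Fin 3) ℝ) :
    ∫ q, (C * rot q).trace ∂μ = (C * meanRot μ).trace := by
  simp only [Matrix.trace, Matrix.diag, Matrix.mul_apply, meanRot, Matrix.of_apply]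
  have hi : ∀ i j, Integrable (fun q => C i j * rot q j i) μ := fun i j =>
    (hμ.integrable (continuous_rot j i)).const_mul _
  rw [integral_finsetSum _ fun i _ => integrable_finsetSum _ fun j _ => hi i j]
  refine Finset.sum_congr rfl fun i _ => ?_
  rw [integral_finsetSum _ fun j _ => hi i j]
  exact Finset.sum_congr rfl fun j _ => integral_const_mul _ _

theorem IsMixed.integral_payoff {μ : Measure ℍ} (hμ : IsMixed μ) (X : Fin 4 → ℝ) (p : ℍ) :
    ∫ q, payoff X p q ∂μ = ((∑ t, X t) * ‖p‖ ^ 2 +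
      (meanRot μ * payoffMatrix X * rot p).trace) / 4 := by
  have := hμ.1
  have h1 : ∫ q, payoff X p q ∂μ = ∫ q, ((∑ t, X t) * ‖p‖ ^ 2 +
      (payoffMatrix X * rot p * rot q).trace) / 4 ∂μ := by
    apply integral_congr_ae
    filter_upwards [hμ.ae_norm_eq_one] with q hq
    rw [payoff_eq, hq]
    ring
  rw [h1, integral_div, integral_add (integrable_const _)
    (hμ.integrable (continuous_trace_mul_rot _)), hμ.integral_trace]
  simp [Matrix.trace_mul_comm (payoffMatrix X * rot p) (meanRot μ), ← Matrix.mul_assoc]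

theorem payoffM_eq {ν μ : Measure ℍ} (hν : IsMixed ν) (hμ : IsMixed μ) (X : Fin 4 → ℝ) :
    payoffM X ν μ = ((∑ t, X t) +
      (meanRot μ * payoffMatrix X * meanRot ν).trace) / 4 := by
  have := hν.1
  simp only [payoffM, hμ.integral_payoff]
  have h1 : ∫ p, ((∑ t, X t) * ‖p‖ ^ 2 +
      (meanRot μ * payoffMatrix X * rot p).trace) / 4 ∂ν = ∫ p, ((∑ t, X t) +
      (meanRot μ * payoffMatrix X * rot p).trace) / 4 ∂ν := by
    apply integral_congr_ae
    filter_upwards [hν.ae_norm_eq_one] with q hq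
    rw [hq]
    ring
  rw [h1, integral_div, integral_add (integrable_const _)
    (hν.integrable (continuous_trace_mul_rot _)), hν.integral_trace]
  simp

theorem isMixed_dirac {p : ℍ} (hp : ‖p‖ = 1) : IsMixed (Measure.dirac p) :=
  ⟨inferInstance, by simp [hp]⟩

theorem meanRot_dirac (p : ℍ) : meanRot (Measure.dirac p) = rot p := by
  ext i j
  simp [meanRot]

theorem stratEquiv_of_meanRot_eq {μ μ' : Measure ℍ} (hμ : IsMixed μ) (hμ' : IsMixed μ')
    (h : meanRot μ = meanRot μ') : StratEquiv μ μ' := by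
  intro p _ t
  simp only [piQ_mul_sq_eq_payoff, hμ.integral_payoff, hμ'.integral_payoff, h]

theorem IsNash.isRotBound_left {X Y : Fin 4 → ℝ} {ν μ : Measure ℍ} (h : IsNash X Y ν μ) :
    IsRotBound (meanRot μ * payoffMatrix X)
      (meanRot μ * payoffMatrix X * meanRot ν).trace := by
  intro p hp
  have := h.2.2.1 _ (isMixed_dirac hp)
  rw [payoffM_eq (isMixed_dirac hp) h.2.1, payoffM_eq h.1 h.2.1, meanRot_dirac] at this
  linarith

theorem IsNash.isRotBound_right {X Y : Fin 4 → ℝ} {ν μ : Measure ℍ} (h : IsNash X Y ν μ) :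
    IsRotBound (payoffMatrix Y * meanRot ν)
      (payoffMatrix Y * meanRot ν * meanRot μ).trace := by
  intro p hp
  have := h.2.2.2 _ (isMixed_dirac hp)
  rw [payoffM_eq h.1 (isMixed_dirac hp), payoffM_eq h.1 h.2.1, meanRot_dirac] at this
  rw [Matrix.trace_mul_comm, Matrix.trace_mul_comm _ (meanRot μ), ← Matrix.mul_assoc,
    ← Matrix.mul_assoc]
  linarith

theorem IsRotBound.trace_eq_of_atom {C : Matrix (Fin 3) (Fin 3) ℝ} {μ : Measure ℍ}
    (hμ : IsMixed μ) (h : IsRotBound C (C * meanRot μ).trace) {q : ℍ} (hq : μ {q} ≠ 0) :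
    (C * rot q).trace = (C * meanRot μ).trace := by
  have := hμ.1
  have hint : Integrable (fun p => (C * meanRot μ).trace - (C * rot p).trace) μ :=
    (integrable_const _).sub (hμ.integrable (continuous_trace_mul_rot C))
  have hnn : 0 ≤ᵐ[μ] fun p => (C * meanRot μ).trace - (C * rot p).trace := by
    filter_upwards [hμ.ae_norm_eq_one] with p hp
    exact sub_nonneg.2 (h p hp)
  have hz := (integral_eq_zero_iff_of_nonneg_ae hnn hint).1 (by
    rw [integral_sub (integrable_const _) (hμ.integrable (continuous_trace_mul_rot C)),
      hμ.integral_trace]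
    simp)
  by_contra hne
  refine hq (measure_mono_null ?_ (ae_iff.1 hz))
  rintro _ rfl
  simpa [sub_eq_zero, eq_comm] using hne

theorem IsMixed.integrable_piQ_sq {μ : Measure ℍ} (hμ : IsMixed μ) (t : Fin 4) :
    Integrable (fun q => piQ t q ^ 2) μ :=
  hμ.integrable ((continuous_piQ t).pow 2)

theorem IsMixed.sum_integral_sq {μ : Measure ℍ} (hμ : IsMixed μ) :
    ∑ t, ∫ q, piQ t q ^ 2 ∂μ = 1 := by
  have := hμ.1
  rw [← integral_finsetSum _ fun t _ => hμ.integrable_piQ_sq t]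
  have : ∫ q, ∑ t, piQ t q ^ 2 ∂μ = ∫ _, (1 : ℝ) ∂μ := by
    apply integral_congr_ae
    filter_upwards [hμ.ae_norm_eq_one] with q hq
    simpa [Fin.sum_univ_four, piQ] using sq_coords_of_norm_eq_one hq
  rw [this]
  simp

theorem integral_sq_nonneg (μ : Measure ℍ) (t : Fin 4) : 0 ≤ ∫ q, piQ t q ^ 2 ∂μ :=
  integral_nonneg fun _ => sq_nonneg _

theorem diagMeasure_apply_image (μ : Measure ℍ) (s : Finset (Fin 4)) :
    diagMeasure μ (basisQ '' s) = ENNReal.ofReal (∑ t ∈ s, ∫ q, piQ t q ^ 2 ∂μ) := by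
  have hm : MeasurableSet (basisQ '' (s : Set (Fin 4))) :=
    (s.finite_toSet.image _).measurableSet
  rw [ENNReal.ofReal_sum_of_nonneg fun t _ => integral_sq_nonneg μ t]
  classical
  simp [diagMeasure, hm, Set.indicator_apply, basisQ_injective.mem_set_image,
    Finset.sum_ite_mem]

theorem IsMixed.diagMeasure {μ : Measure ℍ} (hμ : IsMixed μ) : IsMixed (diagMeasure μ) := by
  have h1 : _root_.diagMeasure μ (Set.range basisQ) = 1 := by
    have := diagMeasure_apply_image μ Finset.univ
    rwa [Finset.coe_univ, Set.image_univ, hμ.sum_integral_sq, ENNReal.ofReal_one] at this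
  have hp : IsProbabilityMeasure (_root_.diagMeasure μ) := by
    constructor
    simp only [_root_.diagMeasure, Measure.finsetSum_apply, Measure.smul_apply,
      measure_univ, smul_eq_mul, mul_one]
    rw [← ENNReal.ofReal_sum_of_nonneg fun t _ => integral_sq_nonneg μ t, hμ.sum_integral_sq,
      ENNReal.ofReal_one]
  refine ⟨hp, le_antisymm prob_le_one (h1 ▸ measure_mono ?_)⟩
  rintro _ ⟨t, rfl⟩
  exact norm_basisQ t

theorem meanRot_diagMeasure (μ : Measure ℍ) (i j : Fin 3) :
    meanRot (diagMeasure μ) i j = ∑ t, (∫ q, piQ t q ^ 2 ∂μ) * rot (basisQ t) i j := by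
  simp only [meanRot, diagMeasure, Matrix.of_apply]
  rw [integral_finsetSum_measure fun t _ =>
    (integrable_dirac (by simp)).smul_measure ENNReal.ofReal_ne_top]
  simp [integral_smul_measure, integral_sq_nonneg]

theorem IsMixed.meanRot_diagMeasure_eq {μ : Measure ℍ} (hμ : IsMixed μ)
    (hd : (meanRot μ).IsDiag) : meanRot (_root_.diagMeasure μ) = meanRot μ := by
  have hsum (f : Fin 4 → ℝ) : ∑ t, (∫ q, piQ t q ^ 2 ∂μ) * f t =
      ∫ q, ∑ t, piQ t q ^ 2 * f t ∂μ := by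
    rw [integral_finsetSum _ fun t _ => (hμ.integrable_piQ_sq t).mul_const _]
    exact Finset.sum_congr rfl fun t _ => (integral_mul_const _ _).symm
  ext i j
  by_cases hij : i = j
  · subst hij
    rw [meanRot_diagMeasure, hsum]
    apply integral_congr_ae
    refine Filter.Eventually.of_forall fun q => ?_
    have h1 : basisQ 0 = 1 := rfl
    simp only [Fin.sum_univ_four, h1, rot_one]
    fin_cases i <;> simp [rot, basisQ, qI, qJ, qK, piQ] <;> ring
  · rw [hd hij, meanRot_diagMeasure]
    have h1 : basisQ 0 = 1 := rfl
    simp only [Fin.sum_univ_four, h1, rot_one]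
    fin_cases i <;> fin_cases j <;> simp [rot, basisQ, qI, qJ, qK] at hij ⊢

theorem diagMeasure_singleton (μ : Measure ℍ) (t : Fin 4) :
    diagMeasure μ {basisQ t} = ENNReal.ofReal (∫ q, piQ t q ^ 2 ∂μ) := by
  simpa using diagMeasure_apply_image μ {t}

theorem IsRotBound.trace_basisQ {C : Matrix (Fin 3) (Fin 3) ℝ} {μ : Measure ℍ}
    (hμ : IsMixed μ) (hd : (meanRot μ).IsDiag) (h : IsRotBound C (C * meanRot μ).trace)
    {t : Fin 4} (ht : ∫ q, piQ t q ^ 2 ∂μ ≠ 0) :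
    (C * rot (basisQ t)).trace = (C * meanRot μ).trace := by
  have he := hμ.meanRot_diagMeasure_eq hd
  rw [← he] at h ⊢
  refine h.trace_eq_of_atom hμ.diagMeasure ?_
  rw [diagMeasure_singleton, Ne, ENNReal.ofReal_eq_zero, not_le]
  exact lt_of_le_of_ne (integral_sq_nonneg μ t) ht.symm

theorem diagMeasure_three_point {μ : Measure ℍ} (hμ : IsMixed μ) {t : Fin 4}
    (ht : ∫ q, piQ t q ^ 2 ∂μ = 0) :
    ∃ S : Set ℍ, S ⊆ {1, qI, qJ, qK} ∧ S.ncard = 3 ∧ diagMeasure μ S = 1 := by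
  refine ⟨basisQ '' ((Finset.univ.erase t : Finset (Fin 4)) : Set (Fin 4)), ?_, ?_, ?_⟩
  · rintro _ ⟨s, -, rfl⟩
    fin_cases s <;> simp [basisQ]
  · rw [Set.ncard_image_of_injective _ basisQ_injective, Set.ncard_coe_finset]
    simp
  · rw [diagMeasure_apply_image, Finset.sum_erase (f := fun s => ∫ q, piQ s q ^ 2 ∂μ) _ ht,
      hμ.sum_integral_sq, ENNReal.ofReal_one]

theorem IsMixed.four_mul_integral_sq {μ : Measure ℍ} (hμ : IsMixed μ) (t : Fin 4) :
    4 * ∫ q, piQ t q ^ 2 ∂μ = 1 + ![meanRot μ 0 0 + meanRot μ 1 1 + meanRot μ 2 2,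
      meanRot μ 0 0 - meanRot μ 1 1 - meanRot μ 2 2,
      - meanRot μ 0 0 + meanRot μ 1 1 - meanRot μ 2 2,
      - meanRot μ 0 0 - meanRot μ 1 1 + meanRot μ 2 2] t := by
  have h := hμ.integral_payoff (Pi.single t 1) 1
  simp only [← piQ_mul_sq_eq_payoff, one_mul] at h
  rw [h, rot_one, Matrix.mul_one]
  fin_cases t <;>
    simp [payoffMatrix, Matrix.trace, Matrix.mul_diagonal, Fin.sum_univ_three] <;> ring

theorem payoffMatrix_generic {X : Fin 4 → ℝ} (hX : Function.Injective X)
    (hX2 : ∀ s t s' t' : Fin 4, s < t → s' < t' → X s + X t = X s' + X t' → s = s' ∧ t = t') :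
    (∀ i, payoffMatrix X i i ≠ 0) ∧
      ∀ i j, i ≠ j → payoffMatrix X i i ^ 2 ≠ payoffMatrix X j j ^ 2 := by
  have hne : ∀ s t, s ≠ t → X s - X t ≠ 0 := fun s t hst => sub_ne_zero.2 (hX.ne hst)
  constructor
  · intro i hi
    fin_cases i <;> simp [payoffMatrix] at hi
    · exact absurd (hX2 0 1 2 3 (by decide) (by decide) (by linarith)) (by decide)
    · exact absurd (hX2 0 2 1 3 (by decide) (by decide) (by linarith)) (by decide)
    · exact absurd (hX2 0 3 1 2 (by decide) (by decide) (by linarith)) (by decide)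
  · intro i j hij h
    rcases sq_eq_sq_iff_eq_or_eq_neg.1 h with h | h <;>
      fin_cases i <;> fin_cases j <;> simp [payoffMatrix] at hij h
    all_goals first
      | exact hne 1 2 (by decide) (by linarith)
      | exact hne 1 3 (by decide) (by linarith)
      | exact hne 2 3 (by decide) (by linarith)
      | exact hne 0 1 (by decide) (by linarith)
      | exact hne 0 2 (by decide) (by linarith)
      | exact hne 0 3 (by decide) (by linarith)

theorem payoffMatrix_eq (X : Fin 4 → ℝ) :
    payoffMatrix X = Matrix.diagonal fun i => payoffMatrix X i i := by
  ext i j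
  simp [payoffMatrix, Matrix.diagonal_apply]

/-- A symmetric `N` with `N * A` a scaled orthogonal matrix is diagonal when the diagonal matrix
`A` has nonzero entries with distinct squares. -/
theorem isDiag_of_mul_diagonal {N : Matrix (Fin 3) (Fin 3) ℝ} {a : Fin 3 → ℝ} {L : ℝ}
    (hN : N.transpose = N) (ha : ∀ i, a i ≠ 0) (ha2 : ∀ i j, i ≠ j → a i ^ 2 ≠ a j ^ 2)
    (h : N * Matrix.diagonal a * (N * Matrix.diagonal a).transpose = L ^ 2 • 1) :
    N.IsDiag ∧ ∀ i, (N i i * a i) ^ 2 = L ^ 2 := by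
  have hdiag : N.IsDiag := by
    rcases eq_or_ne L 0 with rfl | hL
    · have h0 : N * Matrix.diagonal a = 0 := by
        rw [← Matrix.self_mul_conjTranspose_eq_zero, Matrix.conjTranspose_eq_transpose_of_trivial,
          h]
        simp
      intro i j _
      have := congrFun (congrFun h0 i) j
      simpa [Matrix.mul_diagonal, ha j] using this
    · have hinv : N * ((L ^ 2)⁻¹ • (Matrix.diagonal a * Matrix.diagonal a * N)) = 1 := by
        rw [Matrix.mul_smul, inv_smul_eq_iff₀ (by positivity), ← h, Matrix.transpose_mul, hN,
          Matrix.diagonal_transpose]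
        simp only [Matrix.mul_assoc]
      have hinv' := mul_eq_one_comm.1 hinv
      have hcomm : N * (Matrix.diagonal a * Matrix.diagonal a) =
          Matrix.diagonal a * Matrix.diagonal a * N := by
        set D := Matrix.diagonal a * Matrix.diagonal a
        rw [Matrix.smul_mul, inv_smul_eq_iff₀ (by positivity)] at hinv'
        rw [Matrix.mul_smul, inv_smul_eq_iff₀ (by positivity)] at hinv
        have hNN : N * D * N = D * N * N := by rw [hinv', Matrix.mul_assoc, hinv]
        have hr : N * ((L ^ 2)⁻¹ • (D * N)) = 1 := by
          rw [Matrix.mul_smul, inv_smul_eq_iff₀ (by positivity), hinv]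
        calc N * D = N * D * N * ((L ^ 2)⁻¹ • (D * N)) := by
              rw [Matrix.mul_assoc (N * D), hr, Matrix.mul_one]
          _ = D * N := by rw [hNN, Matrix.mul_assoc (D * N), hr, Matrix.mul_one]
      intro i j hij
      have := congrFun (congrFun hcomm i) j
      rw [Matrix.diagonal_mul_diagonal, Matrix.mul_diagonal, Matrix.diagonal_mul] at this
      have h0 : N i j * (a j ^ 2 - a i ^ 2) = 0 := by linear_combination this
      exact (mul_eq_zero.1 h0).resolve_right (sub_ne_zero.2 (ha2 j i hij.symm))
  refine ⟨hdiag, fun i => ?_⟩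
  have hi := congrFun (congrFun h i) i
  rw [Matrix.mul_apply] at hi
  simp only [Matrix.transpose_apply, Matrix.mul_diagonal] at hi
  rw [Finset.sum_eq_single i (by intro j _ hj; simp [hdiag hj.symm])
    (by simp)] at hi
  simpa [← sq] using hi

theorem meanRot_transpose_of_support {μ : Measure ℍ} {s : Set ℍ} (hs : ∀ᵐ q ∂μ, q ∈ s)
    (hsymm : ∀ q ∈ s, (rot q).transpose = rot q) : (meanRot μ).transpose = meanRot μ := by
  ext i j
  apply integral_congr_ae
  filter_upwards [hs] with q hq
  exact congrFun (congrFun (hsymm q hq) i) j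

theorem rot_transpose_of_re_eq_zero {p : ℍ} (hp : p.re = 0) : (rot p).transpose = rot p := by
  ext i j
  fin_cases i <;> fin_cases j <;> simp [rot, hp]

theorem re_eq_zero_of_sq_eq_neg_one {p : ℍ} (hp : p ^ 2 = -1) : p.re = 0 := by
  by_contra h
  rw [sq] at hp
  have h0 : (p * p).re = -1 := by rw [hp]; rfl
  have h1 : (p * p).imI = -0 := by rw [hp]; rfl
  have h2 : (p * p).imJ = -0 := by rw [hp]; rfl
  have h3 : (p * p).imK = -0 := by rw [hp]; rfl
  simp at h0 h1 h2 h3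
  have e1 : p.imI = 0 := mul_left_cancel₀ h (by linarith)
  have e2 : p.imJ = 0 := mul_left_cancel₀ h (by linarith)
  have e3 : p.imK = 0 := mul_left_cancel₀ h (by linarith)
  rw [e1, e2, e3] at h0
  nlinarith [sq_nonneg p.re]

theorem rot_transpose_of_mem_frame {u v : ℍ} (hu2 : u ^ 2 = -1) (hv2 : v ^ 2 = -1)
    (huv : u * v + v * u = 0) {q : ℍ} (hq : q ∈ ({1, u, v, u * v} : Set ℍ)) :
    (rot q).transpose = rot q := by
  rcases hq with rfl | rfl | rfl | rfl
  · rw [rot_one, Matrix.transpose_one]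
  · exact rot_transpose_of_re_eq_zero (re_eq_zero_of_sq_eq_neg_one hu2)
  · exact rot_transpose_of_re_eq_zero (re_eq_zero_of_sq_eq_neg_one hv2)
  · apply rot_transpose_of_re_eq_zero
    have h : (u * v + v * u).re = 0 := by rw [huv]; rfl
    simp at h ⊢
    linarith

theorem IsMixed.meanRot_ne_zero {ν : Measure ℍ} (hν : IsMixed ν) {r : ℍ} (hr : ‖r‖ = 1)
    (h : ∀ᵐ p ∂ν, qinner r p = 0) : meanRot ν ≠ 0 := by
  intro h0
  have := hν.1
  have h1 := hν.integral_trace (rot r).transpose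
  have h2 : ∫ p, ((rot r).transpose * rot p).trace ∂ν = ∫ _, (-1 : ℝ) ∂ν := by
    apply integral_congr_ae
    filter_upwards [h, hν.ae_norm_eq_one] with p hp hp1
    rw [trace_transpose_rot_mul_rot, hp, hp1, hr]
    norm_num
  rw [h2, h0] at h1
  simp at h1

/-- If the mean rotation is diagonal, with entries inversely proportional in absolute value to
numbers of distinct squares, at most one mean squared coordinate vanishes. -/
theorem IsMixed.integral_sq_ne_zero_or {μ : Measure ℍ} (hμ : IsMixed μ) {a : Fin 3 → ℝ} {L : ℝ}
    (ha : ∀ i, a i ≠ 0) (ha2 : ∀ i j, i ≠ j → a i ^ 2 ≠ a j ^ 2)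
    (h : ∀ i, (meanRot μ i i * a i) ^ 2 = L ^ 2) {s t : Fin 4} (hst : s ≠ t) :
    ∫ q, piQ s q ^ 2 ∂μ ≠ 0 ∨ ∫ q, piQ t q ^ 2 ∂μ ≠ 0 := by
  by_contra! hc
  have hs := hμ.four_mul_integral_sq s
  have ht := hμ.four_mul_integral_sq t
  rw [hc.1] at hs
  rw [hc.2] at ht
  have hzero : ∀ i j, i ≠ j → meanRot μ i i ^ 2 = meanRot μ j j ^ 2 → ∀ k, meanRot μ k k = 0 := by
    intro i j hij he k
    have hi := h i
    have hj := h j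
    have hk := h k
    have h0 : meanRot μ i i ^ 2 * (a i ^ 2 - a j ^ 2) = 0 := by
      linear_combination hi - hj - he * a j ^ 2
    have h1 : meanRot μ i i = 0 :=
      pow_eq_zero_iff two_ne_zero |>.1
        ((mul_eq_zero.1 h0).resolve_right (sub_ne_zero.2 (ha2 i j hij)))
    rw [← hi, h1, zero_mul] at hk
    have h2 := pow_eq_zero_iff two_ne_zero |>.1 (hk.trans (zero_pow two_ne_zero))
    exact (mul_eq_zero.1 h2).resolve_right (ha k)
  have hsome : (∀ k, meanRot μ k k = 0) := by
    have key : ∀ i j, i ≠ j → (meanRot μ i i = meanRot μ j j ∨ meanRot μ i i = - meanRot μ j j) →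
        ∀ k, meanRot μ k k = 0 := fun i j hij he => hzero i j hij (sq_eq_sq_iff_eq_or_eq_neg.2 he)
    fin_cases s <;> fin_cases t <;> simp at hst hs ht
    all_goals first
      | exact key 0 1 (by decide) (Or.inl (by linarith))
      | exact key 0 1 (by decide) (Or.inr (by linarith))
      | exact key 0 2 (by decide) (Or.inl (by linarith))
      | exact key 0 2 (by decide) (Or.inr (by linarith))
      | exact key 1 2 (by decide) (Or.inl (by linarith))
      | exact key 1 2 (by decide) (Or.inr (by linarith))
  fin_cases s <;> simp [hsome] at hs

/-- If `μ` is supported on a subset of `{1, u, v, u·v}` and `ν` is supported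
on exactly three pairwise orthogonal unit quaternions, then `(ν,μ)` is equivalent as a pair
to a pair in which each strategy is supported on a three-element subset of `{1, i, j, k}`. -/
theorem three_point_equilibria (X Y : Fin 4 → ℝ) (hG : Generic X Y)
    (ν μ : Measure ℍ) (hnash : IsNash X Y ν μ)
    (u v : ℍ) (hu : ‖u‖ = 1) (hv : ‖v‖ = 1)
    (hu2 : u ^ 2 = -1) (hv2 : v ^ 2 = -1) (huv : u * v + v * u = 0)
    (hμsupp : μ ({1, u, v, u * v} : Set ℍ) = 1)
    (q : Fin 3 → ℍ) (hq1 : ∀ i, ‖q i‖ = 1)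
    (hq2 : ∀ i j, i ≠ j → qinner (q i) (q j) = 0)
    (hνsupp : ν (Set.range q) = 1) (hpos : ∀ i, ν {q i} ≠ 0) :
    ∃ ν' μ' : Measure ℍ, IsMixed ν' ∧ IsMixed μ' ∧ PairEquiv ν μ ν' μ' ∧
      (∃ S T : Set ℍ, S ⊆ {1, qI, qJ, qK} ∧ T ⊆ {1, qI, qJ, qK} ∧
        S.ncard = 3 ∧ T.ncard = 3 ∧ ν' S = 1 ∧ μ' T = 1) := by
  obtain ⟨hX, hY, hX2, hY2⟩ := hG
  obtain ⟨haX, haX2⟩ := payoffMatrix_generic hX hX2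
  obtain ⟨haY, -⟩ := payoffMatrix_generic hY hY2
  have hν := hnash.1
  have hμ := hnash.2.1
  have := hν.1
  have := hμ.1
  have hb₁ := hnash.isRotBound_left
  have hb₂ := hnash.isRotBound_right
  obtain ⟨r, hr, hrq⟩ := exists_orthogonal_unit hq1 hq2
  have hM : meanRot ν ≠ 0 := by
    refine hν.meanRot_ne_zero hr ?_
    filter_upwards [(mem_ae_iff_prob_eq_one (Set.finite_range q).measurableSet).2 hνsupp] with p hp
    obtain ⟨i, rfl⟩ := hp
    exact hrq i
  have hNsymm : (meanRot μ).transpose = meanRot μ :=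
    meanRot_transpose_of_support
      ((mem_ae_iff_prob_eq_one (Set.toFinite {1, u, v, u * v}).measurableSet).2 hμsupp)
      fun _ => rot_transpose_of_mem_frame hu2 hv2 huv
  have hC := hb₁.eq_smul_transpose_rot hq1 hq2 hr hrq fun i => hb₁.trace_eq_of_atom hν (hpos i)
  set L := (meanRot μ * payoffMatrix X * meanRot ν).trace
  have hCC : meanRot μ * payoffMatrix X * (meanRot μ * payoffMatrix X).transpose =
      L ^ 2 • 1 := by
    rw [hC, Matrix.transpose_smul, Matrix.transpose_transpose, Matrix.smul_mul, Matrix.mul_smul,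
      mul_eq_one_comm.1 (rot_mul_transpose hr), smul_smul]
    congr 1
    ring
  rw [payoffMatrix_eq X] at hCC
  obtain ⟨hNdiag, hNsq⟩ := isDiag_of_mul_diagonal hNsymm haX haX2 hCC
  have hBM : (payoffMatrix Y * meanRot ν).IsDiag := hb₂.isDiag fun s t hst =>
    (hμ.integral_sq_ne_zero_or haX haX2 hNsq hst).imp (hb₂.trace_basisQ hμ hNdiag)
      (hb₂.trace_basisQ hμ hNdiag)
  have hcancel : ∀ i j, (payoffMatrix Y * meanRot ν) i j = 0 → meanRot ν i j = 0 := by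
    intro i j h
    rw [payoffMatrix_eq, Matrix.diagonal_mul] at h
    exact (mul_eq_zero.1 h).resolve_left (haY i)
  have hMdiag : (meanRot ν).IsDiag := fun i j hij => hcancel i j (hBM hij)
  obtain ⟨t, ht⟩ : ∃ t, ∫ q, piQ t q ^ 2 ∂μ = 0 := by
    by_contra! hall
    have h0 := hb₂.eq_zero fun t => hb₂.trace_basisQ hμ hNdiag (hall t)
    exact hM (Matrix.ext fun i j => hcancel i j (by rw [h0]; rfl))
  obtain ⟨s, hs⟩ : ∃ s, ∫ p, piQ s p ^ 2 ∂ν = 0 := by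
    by_contra! hall
    have h0 := hb₁.eq_zero fun t => hb₁.trace_basisQ hν hMdiag (hall t)
    have hN : ∀ i, meanRot μ i i = 0 := by
      intro i
      have h := congrFun (congrFun h0 i) i
      rw [payoffMatrix_eq, Matrix.mul_diagonal] at h
      exact (mul_eq_zero.1 h).resolve_right (haX i)
    have h1 := hμ.four_mul_integral_sq t
    rw [ht] at h1
    fin_cases t <;> simp [hN] at h1
  obtain ⟨S, hS, hS3, hS1⟩ := diagMeasure_three_point hν hs
  obtain ⟨T, hT, hT3, hT1⟩ := diagMeasure_three_point hμ ht
  refine ⟨diagMeasure ν, diagMeasure μ, hν.diagMeasure, hμ.diagMeasure, ⟨1, by simp, ?_, ?_⟩,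
    S, T, hS, hT, hS3, hT3, hS1, hT1⟩
  · simpa using stratEquiv_of_meanRot_eq hν hν.diagMeasure (hν.meanRot_diagMeasure_eq hMdiag).symm
  · simpa using stratEquiv_of_meanRot_eq hμ hμ.diagMeasure (hμ.meanRot_diagMeasure_eq hNdiag).symm
end
end
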